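/- arXiv:1101.5730 — 4 statements merged into one kernel-verified Lean document; each statement's English description precedes it below -/
import Mathlib

section
/- Let f, g : ℝ² → (0,∞) be smooth functions and write f_x, f_y, g_x, g_y for their partial derivatives. Set a := 1/(√2·f) and b := 1/(√2·g). Then the system of equations a²·(f_x/f) − b²·(g_x·g/f²) + 2ab·(f_y/f) + a·a_x + b·a_y = 0 and −a²·(f·f_y/g²) + b²·(g_y/g) + 2ab·(g_x/g) + a·b_x + b·b_y = 0 holds at every point of ℝ² if and only if f_y = g_x everywhere on ℝ². (This is the condition that the unit vector field U = (1/(√2 f))∂x + (1/(√2 g))∂y on the double-twisted product ℝ×_{(f,g)}ℝ is geodesic.) -/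
/-- Partial derivative with respect to the first variable. -/
noncomputable def px (f : ℝ × ℝ → ℝ) (p : ℝ × ℝ) : ℝ := fderiv ℝ f p (1, 0)

/-- Partial derivative with respect to the second variable. -/
noncomputable def py (f : ℝ × ℝ → ℝ) (p : ℝ × ℝ) : ℝ := fderiv ℝ f p (0, 1)

lemma fderiv_apply_of_eq_one_div_mul {E : Type*} [NormedAddCommGroup E] [NormedSpace ℝ E]
    {f a : E → ℝ} {c : ℝ} {p : E} (hf : DifferentiableAt ℝ f p) (hfp : f p ≠ 0)
    (ha : ∀ q, a q = 1 / (c * f q)) (v : E) :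
    fderiv ℝ a p v = -(fderiv ℝ f p v) / (c * f p ^ 2) := by
  have haf : a = fun q => c⁻¹ * (f q)⁻¹ := by
    funext q
    rw [ha, one_div, mul_inv]
  have hderiv : HasFDerivAt a (c⁻¹ • (-(f p ^ 2)⁻¹) • fderiv ℝ f p) p := by
    rw [haf]
    exact ((hasDerivAt_inv hfp).comp_hasFDerivAt p hf.hasFDerivAt).const_mul c⁻¹
  rw [hderiv.fderiv]
  simp only [smul_apply, smul_eq_mul, div_eq_mul_inv, mul_inv]
  ring

/-- The unit vector field `U = (1/(√2 f)) ∂x + (1/(√2 g)) ∂y` on the double-twisted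
product `ℝ ×_{(f,g)} ℝ` is geodesic (its coefficients satisfy the geodesic PDE system)
iff `f_y = g_x` everywhere. -/
theorem stmt0 (f g : ℝ × ℝ → ℝ) (hf : ContDiff ℝ (⊤ : ℕ∞) f) (hg : ContDiff ℝ (⊤ : ℕ∞) g)
    (hfpos : ∀ p, 0 < f p) (hgpos : ∀ p, 0 < g p)
    (a b : ℝ × ℝ → ℝ)
    (ha : ∀ p, a p = 1 / (Real.sqrt 2 * f p))
    (hb : ∀ p, b p = 1 / (Real.sqrt 2 * g p)) :
    (∀ p : ℝ × ℝ,
        a p ^ 2 * (px f p / f p) - b p ^ 2 * (px g p * g p / (f p) ^ 2)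
          + 2 * a p * b p * (py f p / f p) + a p * px a p + b p * py a p = 0 ∧
        -(a p ^ 2) * (f p * py f p / (g p) ^ 2) + b p ^ 2 * (py g p / g p)
          + 2 * a p * b p * (px g p / g p) + a p * px b p + b p * py b p = 0)
      ↔ (∀ p : ℝ × ℝ, py f p = px g p) := by
  have hs : Real.sqrt 2 ^ 2 = 2 := Real.sq_sqrt zero_le_two
  have hs0 : Real.sqrt 2 ≠ 0 := by positivity
  refine forall_congr' fun p => ?_
  have hfp := (hfpos p).ne'
  have hgp := (hgpos p).ne'
  have hda := fderiv_apply_of_eq_one_div_mul (hf.differentiable (by simp) p) hfp ha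
  have hdb := fderiv_apply_of_eq_one_div_mul (hg.differentiable (by simp) p) hgp hb
  have hax : px a p = -px f p / (Real.sqrt 2 * f p ^ 2) := hda _
  have hay : py a p = -py f p / (Real.sqrt 2 * f p ^ 2) := hda _
  have hbx : px b p = -px g p / (Real.sqrt 2 * g p ^ 2) := hdb _
  have hby : py b p = -py g p / (Real.sqrt 2 * g p ^ 2) := hdb _
  have hfst : a p ^ 2 * (px f p / f p) - b p ^ 2 * (px g p * g p / (f p) ^ 2)
      + 2 * a p * b p * (py f p / f p) + a p * px a p + b p * py a p
      = (py f p - px g p) / (2 * g p * f p ^ 2) := by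
    rw [hax, hay, ha, hb]
    field_simp
    rw [hs]
    ring
  have hsnd : -(a p ^ 2) * (f p * py f p / (g p) ^ 2) + b p ^ 2 * (py g p / g p)
      + 2 * a p * b p * (px g p / g p) + a p * px b p + b p * py b p
      = (px g p - py f p) / (2 * f p * g p ^ 2) := by
    rw [hbx, hby, ha, hb]
    field_simp
    rw [hs]
    ring
  rw [hfst, hsnd]
  constructor
  · rintro ⟨h, -⟩
    have hden : 2 * g p * f p ^ 2 ≠ 0 := by positivity
    exact sub_eq_zero.mp ((div_eq_zero_iff.mp h).resolve_right hden)
  · intro h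
    simp [h]
end

section
/- Let f, g : ℝ² → (0,∞) be smooth functions with f_y = g_x everywhere. Let γ = (x, y) : ℝ → ℝ² be a differentiable curve satisfying x'(t) = 1/(√2·f(γ(t))) and y'(t) = 1/(√2·g(γ(t))) for all t. Then γ is twice differentiable and satisfies the geodesic equations of the metric f²dx² + g²dy², namely x'' + (f_x/f)·(x')² + 2(f_y/f)·x'y' − (g·g_x/f²)·(y')² = 0 and y'' − (f·f_y/g²)·(x')² + 2(g_x/g)·x'y' + (g_y/g)·(y')² = 0, where the coefficient functions are evaluated at γ(t). -/
theorem hasDerivAt_comp_curve {f : ℝ × ℝ → ℝ} {x y : ℝ → ℝ} {x' y' t : ℝ}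
    (hf : DifferentiableAt ℝ f (x t, y t)) (hx : HasDerivAt x x' t) (hy : HasDerivAt y y' t) :
    HasDerivAt (fun s => f (x s, y s)) (px f (x t, y t) * x' + py f (x t, y t) * y') t := by
  have h := hf.hasFDerivAt.comp_hasDerivAt t (hx.prodMk hy)
  have hv : ((x', y') : ℝ × ℝ) = x' • ((1, 0) : ℝ × ℝ) + y' • ((0, 1) : ℝ × ℝ) := by simp
  rw [hv, map_add, map_smul, map_smul] at h
  refine h.congr_deriv ?_
  simp only [px, py, smul_eq_mul]
  ring

theorem hasDerivAt_one_div_const_mul_comp_curve {f : ℝ × ℝ → ℝ} {x y : ℝ → ℝ} {c x' y' t : ℝ}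
    (hc : c ≠ 0) (hf : DifferentiableAt ℝ f (x t, y t)) (hf0 : f (x t, y t) ≠ 0)
    (hx : HasDerivAt x x' t) (hy : HasDerivAt y y' t) :
    HasDerivAt (fun s => 1 / (c * f (x s, y s)))
      (-(px f (x t, y t) * x' + py f (x t, y t) * y') / (c * f (x t, y t) ^ 2)) t := by
  simp only [one_div]
  refine (((hasDerivAt_comp_curve hf hx hy).const_mul c).fun_inv
    (mul_ne_zero hc hf0)).congr_deriv ?_
  field_simp

/-- If `f_y = g_x` everywhere, any integral curve of the unit vector field
`U = (1/(√2 f)) ∂x + (1/(√2 g)) ∂y` is twice differentiable and satisfies the geodesic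
equations of the metric `f² dx² + g² dy²`. -/
theorem stmt3 (f g : ℝ × ℝ → ℝ) (hf : ContDiff ℝ (⊤ : ℕ∞) f) (hg : ContDiff ℝ (⊤ : ℕ∞) g)
    (hfpos : ∀ p, 0 < f p) (hgpos : ∀ p, 0 < g p)
    (hcomm : ∀ p, py f p = px g p)
    (x y : ℝ → ℝ)
    (hx : ∀ t, HasDerivAt x (1 / (Real.sqrt 2 * f (x t, y t))) t)
    (hy : ∀ t, HasDerivAt y (1 / (Real.sqrt 2 * g (x t, y t))) t) :
    (∀ t, DifferentiableAt ℝ (deriv x) t) ∧ (∀ t, DifferentiableAt ℝ (deriv y) t) ∧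
    ∀ t : ℝ,
      (deriv (deriv x) t
          + (px f (x t, y t) / f (x t, y t)) * (deriv x t) ^ 2
          + 2 * (py f (x t, y t) / f (x t, y t)) * deriv x t * deriv y t
          - (g (x t, y t) * px g (x t, y t) / (f (x t, y t)) ^ 2) * (deriv y t) ^ 2 = 0) ∧
      (deriv (deriv y) t
          - (f (x t, y t) * py f (x t, y t) / (g (x t, y t)) ^ 2) * (deriv x t) ^ 2
          + 2 * (px g (x t, y t) / g (x t, y t)) * deriv x t * deriv y t
          + (py g (x t, y t) / g (x t, y t)) * (deriv y t) ^ 2 = 0) := by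
  have hs : Real.sqrt 2 ≠ 0 := by positivity
  have hdx : deriv x = fun t => 1 / (Real.sqrt 2 * f (x t, y t)) := funext fun t => (hx t).deriv
  have hdy : deriv y = fun t => 1 / (Real.sqrt 2 * g (x t, y t)) := funext fun t => (hy t).deriv
  have hxx (t : ℝ) := hasDerivAt_one_div_const_mul_comp_curve hs
    (hf.differentiable (by simp) (x t, y t)) (hfpos _).ne' (hx t) (hy t)
  have hyy (t : ℝ) := hasDerivAt_one_div_const_mul_comp_curve hs
    (hg.differentiable (by simp) (x t, y t)) (hgpos _).ne' (hx t) (hy t)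
  rw [hdx, hdy]
  refine ⟨fun t => (hxx t).differentiableAt, fun t => (hyy t).differentiableAt, fun t => ?_⟩
  rw [(hxx t).deriv, (hyy t).deriv, hcomm]
  have hf0 := (hfpos (x t, y t)).ne'
  have hg0 := (hgpos (x t, y t)).ne'
  constructor
  · field_simp
    ring
  · field_simp
    ring
end

section
/- Let λ₁, λ₂ : ℝ² → ℝ be smooth functions with λ₁ ≥ 1 and λ₂ ≥ 1 everywhere, and let d(p,q) be the infimum of lengths L(γ) = ∫_0^1 √(λ₁(γ(t))·x'(t)² + λ₂(γ(t))·y'(t)²) dt over C¹ curves γ = (x,y) : [0,1] → ℝ² from p to q. Then (ℝ², d) is complete: every sequence (p_k) in ℝ² that is Cauchy with respect to d converges with respect to d to some point p ∈ ℝ². -/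
/-- The Riemannian distance of the double-twisted metric `λ₁ dx² + λ₂ dy²` on `ℝ²`:
the infimum of lengths of `C¹` curves on `[0,1]` joining `p` to `q`. -/
noncomputable def twistedDist (lam1 lam2 : ℝ × ℝ → ℝ) (p q : ℝ × ℝ) : ℝ :=
  sInf {L : ℝ | ∃ x y : ℝ → ℝ, ContDiff ℝ 1 x ∧ ContDiff ℝ 1 y ∧
    (x 0, y 0) = p ∧ (x 1, y 1) = q ∧
    L = ∫ t in (0:ℝ)..1,
      Real.sqrt (lam1 (x t, y t) * (deriv x t) ^ 2 + lam2 (x t, y t) * (deriv y t) ^ 2)}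

theorem twistedDist_set_nonempty (lam1 lam2 : ℝ × ℝ → ℝ) (p q : ℝ × ℝ) :
    {L : ℝ | ∃ x y : ℝ → ℝ, ContDiff ℝ 1 x ∧ ContDiff ℝ 1 y ∧
      (x 0, y 0) = p ∧ (x 1, y 1) = q ∧
      L = ∫ t in (0:ℝ)..1,
        Real.sqrt (lam1 (x t, y t) * (deriv x t) ^ 2
          + lam2 (x t, y t) * (deriv y t) ^ 2)}.Nonempty :=
  ⟨_, fun t => p.1 + t * (q.1 - p.1), fun t => p.2 + t * (q.2 - p.2),
    by fun_prop, by fun_prop, by simp, by simp, rfl⟩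

theorem abs_sub_le_integral_of_abs_deriv_le {f g : ℝ → ℝ} (hf : ContDiff ℝ 1 f)
    (hg : Continuous g) (h : ∀ t, |deriv f t| ≤ g t) :
    |f 1 - f 0| ≤ ∫ t in (0:ℝ)..1, g t := by
  have hf' : Continuous (deriv f) := hf.continuous_deriv le_rfl
  rw [← intervalIntegral.integral_deriv_eq_sub
    (fun t _ => (hf.differentiable one_ne_zero).differentiableAt)
    (hf'.intervalIntegrable 0 1), ← Real.norm_eq_abs]
  exact intervalIntegral.norm_integral_le_of_norm_le zero_le_one
    (Filter.Eventually.of_forall fun t _ => h t) (hg.intervalIntegrable 0 1)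

theorem dist_le_twistedDist {lam1 lam2 : ℝ × ℝ → ℝ}
    (hc1 : Continuous lam1) (hc2 : Continuous lam2)
    (h1 : ∀ p, 1 ≤ lam1 p) (h2 : ∀ p, 1 ≤ lam2 p) (p q : ℝ × ℝ) :
    dist p q ≤ twistedDist lam1 lam2 p q := by
  refine le_csInf (twistedDist_set_nonempty lam1 lam2 p q) ?_
  rintro L ⟨x, y, hx, hy, rfl, rfl, rfl⟩
  have hx' : Continuous (deriv x) := hx.continuous_deriv le_rfl
  have hy' : Continuous (deriv y) := hy.continuous_deriv le_rfl
  have hxc := hx.continuous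
  have hyc := hy.continuous
  have hcont : Continuous fun t => Real.sqrt (lam1 (x t, y t) * (deriv x t) ^ 2
      + lam2 (x t, y t) * (deriv y t) ^ 2) := by fun_prop
  rw [dist_comm, Prod.dist_eq, Real.dist_eq, Real.dist_eq]
  refine max_le (abs_sub_le_integral_of_abs_deriv_le hx hcont fun t => ?_)
    (abs_sub_le_integral_of_abs_deriv_le hy hcont fun t => ?_) <;>
  · refine Real.abs_le_sqrt ?_
    nlinarith [mul_nonneg (sub_nonneg.2 (h1 (x t, y t))) (sq_nonneg (deriv x t)),
      mul_nonneg (sub_nonneg.2 (h2 (x t, y t))) (sq_nonneg (deriv y t)),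
      sq_nonneg (deriv x t), sq_nonneg (deriv y t)]

theorem twistedDist_le_of_le_on_segment {lam1 lam2 : ℝ × ℝ → ℝ} {C : ℝ} {p q : ℝ × ℝ}
    (hC : 0 ≤ C) (h1 : ∀ z ∈ segment ℝ p q, lam1 z ≤ C) (h2 : ∀ z ∈ segment ℝ p q, lam2 z ≤ C) :
    twistedDist lam1 lam2 p q ≤ Real.sqrt (2 * C) * dist p q := by
  have hbdd : BddBelow {L : ℝ | ∃ x y : ℝ → ℝ, ContDiff ℝ 1 x ∧ ContDiff ℝ 1 y ∧
      (x 0, y 0) = p ∧ (x 1, y 1) = q ∧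
      L = ∫ t in (0:ℝ)..1,
        Real.sqrt (lam1 (x t, y t) * (deriv x t) ^ 2 + lam2 (x t, y t) * (deriv y t) ^ 2)} := by
    refine ⟨0, ?_⟩
    rintro L ⟨x, y, -, -, -, -, rfl⟩
    exact intervalIntegral.integral_nonneg zero_le_one fun t _ => Real.sqrt_nonneg _
  refine (csInf_le hbdd ⟨fun t => p.1 + t * (q.1 - p.1), fun t => p.2 + t * (q.2 - p.2),
    by fun_prop, by fun_prop, by simp, by simp, rfl⟩).trans ?_
  refine (Real.le_norm_self _).trans ((intervalIntegral.norm_integral_le_of_norm_le_const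
    (C := Real.sqrt (2 * C) * dist p q) fun t ht => ?_).trans (by simp))
  rw [Set.uIoc_of_le zero_le_one] at ht
  have hz : (p.1 + t * (q.1 - p.1), p.2 + t * (q.2 - p.2)) ∈ segment ℝ p q := by
    rw [segment_eq_image']
    exact ⟨t, ⟨ht.1.le, ht.2⟩, by ext <;> simp⟩
  have hd1 : (q.1 - p.1) ^ 2 ≤ dist p q ^ 2 := by
    rw [dist_comm]
    exact sq_le_sq.2 ((le_max_left _ _).trans (le_abs_self (dist q p)))
  have hd2 : (q.2 - p.2) ^ 2 ≤ dist p q ^ 2 := by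
    rw [dist_comm]
    exact sq_le_sq.2 ((le_max_right _ _).trans (le_abs_self (dist q p)))
  rw [Real.norm_of_nonneg (Real.sqrt_nonneg _), ← Real.sqrt_sq (dist_nonneg (x := p) (y := q)),
    ← Real.sqrt_mul (by positivity)]
  have hderiv (a b : ℝ) : deriv (fun s : ℝ => a + s * b) t = b := by
    simp
  rw [hderiv, hderiv]
  refine Real.sqrt_le_sqrt ?_
  have e1 := mul_le_mul_of_nonneg_right (h1 _ hz) (sq_nonneg (q.1 - p.1))
  have e2 := mul_le_mul_of_nonneg_right (h2 _ hz) (sq_nonneg (q.2 - p.2))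
  have e3 := mul_le_mul_of_nonneg_left hd1 hC
  have e4 := mul_le_mul_of_nonneg_left hd2 hC
  linarith

/-- The double-twisted product `ℝ ×_{(λ₁,λ₂)} ℝ` with smooth twisting functions `≥ 1`
is complete: every sequence that is Cauchy for the twisted distance converges for the
twisted distance. -/
theorem stmt6 (lam1 lam2 : ℝ × ℝ → ℝ)
    (hlam1s : ContDiff ℝ (⊤ : ℕ∞) lam1) (hlam2s : ContDiff ℝ (⊤ : ℕ∞) lam2)
    (hlam1 : ∀ p, 1 ≤ lam1 p) (hlam2 : ∀ p, 1 ≤ lam2 p)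
    (pk : ℕ → ℝ × ℝ)
    (hcauchy : ∀ ε > (0:ℝ), ∃ N : ℕ, ∀ m ≥ N, ∀ n ≥ N,
      twistedDist lam1 lam2 (pk m) (pk n) < ε) :
    ∃ p : ℝ × ℝ, ∀ ε > (0:ℝ), ∃ N : ℕ, ∀ n ≥ N,
      twistedDist lam1 lam2 (pk n) p < ε := by
  have hc1 := hlam1s.continuous
  have hc2 := hlam2s.continuous
  have hseq : CauchySeq pk := Metric.cauchySeq_iff.2 fun ε hε =>
    (hcauchy ε hε).imp fun N hN m hm n hn =>
      (dist_le_twistedDist hc1 hc2 hlam1 hlam2 _ _).trans_lt (hN m hm n hn)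
  obtain ⟨p, hp⟩ := cauchySeq_tendsto_of_complete hseq
  refine ⟨p, fun ε hε => ?_⟩
  set C := max (lam1 p) (lam2 p) + 1
  have hC : 0 ≤ C := by linarith [le_max_left (lam1 p) (lam2 p), hlam1 p]
  have hnear : ∀ᶠ z in nhds p, lam1 z ≤ C ∧ lam2 z ≤ C :=
    (hc1.continuousAt.eventually_le_const
      (by linarith [le_max_left (lam1 p) (lam2 p)] : lam1 p < C)).and
    (hc2.continuousAt.eventually_le_const
      (by linarith [le_max_right (lam1 p) (lam2 p)] : lam2 p < C))
  obtain ⟨r, hr, hball⟩ := Metric.eventually_nhds_iff_ball.1 hnear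
  have hlim : Filter.Tendsto (fun n => Real.sqrt (2 * C) * dist (pk n) p)
      Filter.atTop (nhds 0) := by
    simpa using (tendsto_iff_dist_tendsto_zero.1 hp).const_mul (Real.sqrt (2 * C))
  refine Filter.eventually_atTop.1 ?_
  filter_upwards [hlim.eventually_lt_const hε, hp.eventually (Metric.ball_mem_nhds p hr)]
    with n hn hnr
  have hseg : segment ℝ (pk n) p ⊆ Metric.ball p r :=
    (convex_ball p r).segment_subset hnr (Metric.mem_ball_self hr)
  exact (twistedDist_le_of_le_on_segment hC (fun z hz => (hball z (hseg hz)).1)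
    fun z hz => (hball z (hseg hz)).2).trans_lt hn
end

section
/- Let f, g : ℝ → (0,∞) be smooth, and let γ = (x, y) : ℝ → ℝ² be a differentiable curve satisfying x'(t) = 1/(√2·f(x(t))) and y'(t) = −1/(√2·g(y(t))) for all t (an integral curve of the unit vector field V = (1/(√2 f))∂x − (1/(√2 g))∂y, which is orthogonal to N = (1/(√2 f))∂x + (1/(√2 g))∂y in the metric f(x)²dx² + g(y)²dy²). Let Φ(x,y) = (∫₀ˣ f(s) ds, ∫₀ʸ g(s) ds). Then Φ(γ(t)) = Φ(γ(0)) + t·(1/√2, −1/√2) for all t; in particular γ is a unit-speed geodesic of the metric f(x)²dx² + g(y)²dy², so the leaves of the foliation normal to N are geodesics. -/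
/-- If `u` solves `u' = c / h(u)` with `h` continuous and nonvanishing, then the primitive of `h`
is affine with slope `c` along `u`. -/
theorem intervalIntegral_comp_eq_add_mul {h u : ℝ → ℝ} {c : ℝ} (hh : Continuous h)
    (hne : ∀ s, h s ≠ 0) (hu : ∀ t, HasDerivAt u (c / h (u t)) t) (a t : ℝ) :
    ∫ s in a..u t, h s = (∫ s in a..u 0, h s) + t * c := by
  have hderiv : ∀ r, HasDerivAt (fun r => (∫ s in a..u r, h s) - r * c) 0 r := fun r => by
    have h₁ := (hh.integral_hasStrictDerivAt a (u r)).hasDerivAt.comp r (hu r)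
    have h₂ := h₁.sub ((hasDerivAt_id r).mul_const c)
    rwa [mul_div_cancel₀ _ (hne (u r)), one_mul, sub_self] at h₂
  have hconst := is_const_of_deriv_eq_zero (fun r => (hderiv r).differentiableAt)
    (fun r => (hderiv r).deriv) t 0
  simp only [zero_mul, sub_zero] at hconst
  linarith

/-- An integral curve `γ = (x,y)` of the unit vector field
`V = (1/(√2 f)) ∂x − (1/(√2 g)) ∂y` (orthogonal to `N = (1/(√2 f)) ∂x + (1/(√2 g)) ∂y`
in the metric `f(x)² dx² + g(y)² dy²`) is mapped by `Φ(x,y) = (∫₀ˣ f, ∫₀ʸ g)` onto the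
straight line `Φ(γ(0)) + t·(1/√2, −1/√2)`; in particular the leaves of the foliation
normal to `N` are unit-speed geodesics. -/
theorem stmt12 (f g : ℝ → ℝ) (hf : ContDiff ℝ (⊤ : ℕ∞) f) (hg : ContDiff ℝ (⊤ : ℕ∞) g)
    (hfpos : ∀ s, 0 < f s) (hgpos : ∀ s, 0 < g s)
    (Φ : ℝ × ℝ → ℝ × ℝ)
    (hΦ : ∀ p : ℝ × ℝ, Φ p = (∫ s in (0:ℝ)..p.1, f s, ∫ s in (0:ℝ)..p.2, g s))
    (x y : ℝ → ℝ)
    (hx : ∀ t, HasDerivAt x (1 / (Real.sqrt 2 * f (x t))) t)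
    (hy : ∀ t, HasDerivAt y (-(1 / (Real.sqrt 2 * g (y t)))) t) :
    ∀ t : ℝ, Φ (x t, y t)
      = ((Φ (x 0, y 0)).1 + t * (1 / Real.sqrt 2),
         (Φ (x 0, y 0)).2 + t * (-(1 / Real.sqrt 2))) := by
  intro t
  simp only [hΦ, Prod.mk.injEq]
  constructor
  · refine intervalIntegral_comp_eq_add_mul hf.continuous (fun s => (hfpos s).ne')
      (fun r => ?_) 0 t
    rw [div_div]
    exact hx r
  · refine intervalIntegral_comp_eq_add_mul hg.continuous (fun s => (hgpos s).ne')
      (fun r => ?_) 0 t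
    rw [neg_div, div_div]
    exact hy r
end
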